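/- Let C ⊂ ℝ³ be a convex body and r₀ ∈ ∂C a ridge point whose tangent cone is the dihedral angle {r : (r − r₀, e₁) ≤ 0, (r − r₀, e₂) ≤ 0}, and let e = λ₁e₁ + λ₂e₂ with λ₁ > 0, λ₂ > 0, |e| = 1. Then limsup_{t→0⁺} |S_t| / |B_t| ≤ √2 / √(1 + (e₁, e₂)); in particular the ratio of the surface area of S_t to the area of B_t is bounded as t → 0. -/

import Mathlib

open MeasureTheory Set Filter Topology
open scoped RealInnerProductSpace ENNReal

noncomputable section

attribute [local instance] Classical.propDecidable

abbrev E3 := EuclideanSpace ℝ (Fin 3)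

/-- A convex body: a compact convex set with nonempty interior. -/
def IsConvexBody (C : Set E3) : Prop :=
  IsCompact C ∧ Convex ℝ C ∧ (interior C).Nonempty

/-- The tangent cone to a convex set `C` at the point `r₀`: the closure of the set of
rays from `r₀` through points of `C`, translated to the origin. -/
def tanCone (C : Set E3) (r₀ : E3) : Set E3 :=
  closure {v : E3 | ∃ c : ℝ, ∃ r ∈ C, 0 ≤ c ∧ v = c • (r - r₀)}

/-- The dihedral angle `{v : ⟪v,e₁⟫ ≤ 0, ⟪v,e₂⟫ ≤ 0}` (as a cone of displacements). -/
def dihedral (e₁ e₂ : E3) : Set E3 := {v : E3 | ⟪v, e₁⟫ ≤ 0 ∧ ⟪v, e₂⟫ ≤ 0}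

/-- `n` is an outward unit normal of `C` at `r`. -/
def IsOutwardNormalAt (C : Set E3) (r n : E3) : Prop :=
  ‖n‖ = 1 ∧ ∀ x ∈ C, ⟪x - r, n⟫ ≤ 0

/-- `r` is a regular boundary point: the outward unit normal exists and is unique. -/
def IsRegularPt (C : Set E3) (r : E3) : Prop :=
  ∃! n : E3, IsOutwardNormalAt C r n

/-- The (Gauss) normal map of `C`, sending a boundary point to an outward unit normal
(the unique one at regular points), and junk value `0` elsewhere. -/
def normalMap (C : Set E3) (r : E3) : E3 :=
  if h : ∃ n : E3, IsOutwardNormalAt C r n then h.choose else 0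

/-- `B_t = C ∩ {r : ⟪r - r₀, e⟫ = -t}`. -/
def Bset (C : Set E3) (r₀ e : E3) (t : ℝ) : Set E3 :=
  C ∩ {r : E3 | ⟪r - r₀, e⟫ = -t}

/-- `S_t = ∂C ∩ {r : ⟪r - r₀, e⟫ ≥ -t}`. -/
def Sset (C : Set E3) (r₀ e : E3) (t : ℝ) : Set E3 :=
  frontier C ∩ {r : E3 | ⟪r - r₀, e⟫ ≥ -t}

/-- The normalized surface measure `ν_t` induced by `S_t`: the pushforward under the
normal map of the 2-dimensional Hausdorff measure restricted to the regular points of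
`S_t`, normalized by the area of `B_t`. -/
def nuT (C : Set E3) (r₀ e : E3) (t : ℝ) : Measure E3 :=
  (μH[2] (Bset C r₀ e t))⁻¹ •
    Measure.map (normalMap C) (μH[2].restrict (Sset C r₀ e t ∩ {r : E3 | IsRegularPt C r}))

/-- The arc `Γ = {μ₁e₁ + μ₂e₂ : |μ₁e₁ + μ₂e₂| = 1, μ₁ ≥ 0, μ₂ ≥ 0}`. -/
def arcGamma (e₁ e₂ : E3) : Set E3 :=
  {v : E3 | ∃ m₁ m₂ : ℝ, 0 ≤ m₁ ∧ 0 ≤ m₂ ∧ v = m₁ • e₁ + m₂ • e₂ ∧ ‖v‖ = 1}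

/-- Weak convergence of the family `ν t` to `ν₀` as `t → 0⁺`. -/
def WeaklyTendsto (ν : ℝ → Measure E3) (ν₀ : Measure E3) : Prop :=
  ∀ f : BoundedContinuousFunction E3 ℝ,
    Tendsto (fun t => ∫ x, f x ∂(ν t)) (𝓝[>] (0 : ℝ)) (𝓝 (∫ x, f x ∂ν₀))

/-- `ν₀` is a partial weak limit of the family `ν t` as `t → 0⁺`. -/
def IsPartialWeakLimit (ν : ℝ → Measure E3) (ν₀ : Measure E3) : Prop :=
  ∃ ts : ℕ → ℝ, (∀ i, 0 < ts i) ∧ Tendsto ts atTop (𝓝 (0 : ℝ)) ∧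
    ∀ f : BoundedContinuousFunction E3 ℝ,
      Tendsto (fun i => ∫ x, f x ∂(ν (ts i))) atTop (𝓝 (∫ x, f x ∂ν₀))

/-- The support of a measure: points all of whose open neighborhoods have positive measure. -/
def msupport (ν : Measure E3) : Set E3 :=
  {x : E3 | ∀ U : Set E3, IsOpen U → x ∈ U → 0 < ν U}

abbrev E2 := EuclideanSpace ℝ (Fin 2)

lemma meas_le_of_antilip {s : Set E3} {f : E3 → E2} (K : NNReal)
    (h : ∀ x ∈ s, ∀ y ∈ s, dist x y ≤ K * dist (f x) (f y)) :
    μH[2] s ≤ (K : ℝ≥0∞) ^ (2:ℝ) * μH[2] (f '' s) := by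
  have h1 : AntilipschitzWith K (fun x : s => f x) :=
    AntilipschitzWith.of_le_mul_dist fun x y => h x x.2 y y.2
  have h2 := h1.le_hausdorffMeasure_image (d := 2) (by norm_num) univ
  have h3 := (isometry_subtype_coe (s := s)).hausdorffMeasure_image (d := 2)
    (Or.inl (by norm_num)) univ
  rw [image_univ, Subtype.range_coe] at h3
  rw [h3]
  refine h2.trans ?_
  gcongr
  rintro _ ⟨x, -, rfl⟩
  exact ⟨x, x.2, rfl⟩

instance haarE2 : (μH[2] : Measure E2).IsAddHaarMeasure := by
  have := isAddHaarMeasure_hausdorffMeasure (E := E2)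
  simpa using this

def scaleMap (r : ℝ) : E2 →ₗ[ℝ] E2 := Matrix.toEuclideanLin !![r, 0; 0, 1]

lemma scaleMap_apply (r : ℝ) (q : E2) : scaleMap r q = !₂[r * q 0, q 1] := by
  ext i
  fin_cases i <;> simp [scaleMap, Matrix.toLpLin_apply, dotProduct, Fin.sum_univ_two]

lemma meas_scaleMap (r : ℝ) (hr : 0 ≤ r) (X : Set E2) :
    μH[2] (scaleMap r '' X) = ENNReal.ofReal r * μH[2] X := by
  rw [Measure.addHaar_image_linearMap]
  congr 2
  rw [scaleMap, Matrix.toEuclideanLin_eq_toLin_orthonormal, LinearMap.det_toLin]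
  simp [Matrix.det_fin_two, abs_of_nonneg hr]

lemma rect_meas : ∃ k : NNReal, 0 < k ∧ ∀ a b c d : ℝ, a ≤ b → c ≤ d →
    μH[2] {q : E2 | (a ≤ q 0 ∧ q 0 ≤ b) ∧ (c ≤ q 1 ∧ q 1 ≤ d)} =
      k * ENNReal.ofReal ((b - a) * (d - c)) := by
  refine ⟨Measure.addHaarScalarFactor μH[2] (volume : Measure E2),
    Measure.addHaarScalarFactor_pos_of_isAddHaarMeasure _ _, ?_⟩
  intro a b c d hab hcd
  have h1 := Measure.isAddLeftInvariant_eq_smul (μH[2] : Measure E2) volume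
  conv_lhs => rw [h1]
  have h2 := (PiLp.volume_preserving_ofLp (Fin 2)).measure_preimage
    (measurableSet_Icc (a := ![a, c]) (b := ![b, d])).nullMeasurableSet
  rw [Real.volume_Icc_pi] at h2
  simp only [Measure.smul_apply, ENNReal.smul_def, smul_eq_mul]
  rw [ENNReal.ofReal_mul (by linarith)]
  congr 1
  convert h2 using 1
  · congr 1
    ext q
    simp [Pi.le_def, Fin.forall_fin_two]
    tauto
  · simp [Fin.prod_univ_two]

/-- Supporting normal at the end of a ray avoiding the interior. -/
lemma exists_normal {C : Set E3} (hC : IsConvexBody C) {q v : E3} (hq : q ∈ C)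
    (hd : ∀ σ : ℝ, 0 < σ → q + σ • v ∉ interior C) :
    ∃ n, IsOutwardNormalAt C q n ∧ 0 ≤ ⟪v, n⟫ := by
  obtain ⟨hcomp, hconv, hint⟩ := hC
  have hray : Convex ℝ ((fun σ : ℝ => q + σ • v) '' Ioi 0) := by
    rintro _ ⟨x, hx, rfl⟩ _ ⟨y, hy, rfl⟩ a b ha hb hab
    refine ⟨a * x + b * y, ?_, ?_⟩
    · exact (convex_Ioi (0:ℝ)) hx hy ha hb hab
    · have : b = 1 - a := by linarith
      subst this
      simp only [smul_add, smul_smul, add_smul, sub_smul, one_smul]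
      abel
  obtain ⟨f, u, h1, h2⟩ := geometric_hahn_banach_open hconv.interior isOpen_interior hray (by
    rw [Set.disjoint_left]
    rintro _ h ⟨σ, hσ, rfl⟩
    exact hd σ hσ h)
  have hcl : closure (interior C) = C := by
    rw [hconv.closure_interior_eq_closure_of_nonempty_interior hint, hcomp.isClosed.closure_eq]
  have h3 : ∀ x ∈ C, f x ≤ u := by
    intro x hx
    rw [← hcl] at hx
    exact closure_minimal (fun y hy => (h1 y hy).le) (isClosed_le f.continuous continuous_const) hx
  have h4 : ∀ σ : ℝ, 0 < σ → u ≤ f q + σ * f v := by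
    intro σ hσ
    simpa using h2 _ ⟨σ, hσ, rfl⟩
  have h5 : u ≤ f q := by
    by_contra hlt
    push Not at hlt
    have hv : 0 < |f v| + 1 := by positivity
    have := h4 ((u - f q) / 2 / (|f v| + 1)) (by have : 0 < u - f q := by linarith
                                                 positivity)
    have h6 : (u - f q) / 2 / (|f v| + 1) * f v ≤ (u - f q) / 2 := by
      rw [div_mul_eq_mul_div, div_le_iff₀ hv]
      have : 0 < u - f q := by linarith
      nlinarith [le_abs_self (f v)]
    linarith
  have h6 : f q = u := le_antisymm (h3 q hq) h5
  have h7 : 0 ≤ f v := by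
    have := h4 1 one_pos
    linarith
  set n0 : E3 := (InnerProductSpace.toDual ℝ E3).symm f with hn0
  have hfn : ∀ x, f x = ⟪x, n0⟫ := by
    intro x
    rw [real_inner_comm]
    simp [hn0]
  have hn0ne : n0 ≠ 0 := by
    intro h0
    obtain ⟨x, hx⟩ := hint
    have := h1 x hx
    rw [hfn, h0, inner_zero_right] at this
    rw [hfn, h0, inner_zero_right] at h6
    linarith
  have hpos : 0 < ‖n0‖ := norm_pos_iff.mpr hn0ne
  refine ⟨‖n0‖⁻¹ • n0, ⟨?_, ?_⟩, ?_⟩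
  · rw [norm_smul, norm_inv, norm_norm, inv_mul_cancel₀ hpos.ne']
  · intro x hx
    rw [inner_smul_right, ← hfn, map_sub]
    have := h3 x hx
    exact mul_nonpos_of_nonneg_of_nonpos (by positivity) (by linarith)
  · rw [inner_smul_right, ← hfn]
    positivity

structure Setup (C : Set E3) (r₀ w m z e : E3) (c s M : ℝ) : Prop where
  body : IsConvexBody C
  mem : r₀ ∈ C
  dec : ∀ x y : E3, ⟪x, y⟫ = ⟪x, w⟫ * ⟪y, w⟫ + ⟪x, m⟫ * ⟪y, m⟫ + ⟪x, z⟫ * ⟪y, z⟫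
  ww : ⟪w, w⟫ = 1
  mm : ⟪m, m⟫ = 1
  zz : ⟪z, z⟫ = 1
  wm : ⟪w, m⟫ = 0
  wz : ⟪w, z⟫ = 0
  mz : ⟪m, z⟫ = 0
  c_pos : 0 < c
  s_pos : 0 < s
  cs : c ^ 2 + s ^ 2 = 1
  ez : ⟪e, z⟫ = 0
  em : 0 < ⟪e, m⟫
  normal : ∀ n, IsOutwardNormalAt C r₀ n → ⟪n, z⟫ = 0 ∧ c * |⟪n, w⟫| ≤ s * ⟪n, m⟫
  M_pos : 0 < M
  bound : ∀ p ∈ C, |⟪p - r₀, w⟫| ≤ M * (-⟪p - r₀, e⟫) ∧ |⟪p - r₀, m⟫| ≤ M * (-⟪p - r₀, e⟫)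

namespace Setup

variable {C : Set E3} {r₀ w m z e : E3} {c s M : ℝ}

lemma neg (h : Setup C r₀ w m z e c s M) : Setup C r₀ w m (-z) e c s M := by
  obtain ⟨h1, h2, h3, h4, h5, h6, h7, h8, h9, h10, h11, h12, h13, h14, h15, h16, h17⟩ := h
  refine ⟨h1, h2, ?_, h4, h5, ?_, h7, ?_, ?_, h10, h11, h12, ?_, h14, ?_, h16, h17⟩
  all_goals simp only [inner_neg_right, inner_neg_left, neg_neg, neg_eq_zero, neg_mul_neg]
  all_goals assumption

lemma height_nonneg (h : Setup C r₀ w m z e c s M) {p : E3} (hp : p ∈ C) :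
    0 ≤ -⟪p - r₀, e⟫ := by
  have h1 := (abs_nonneg _).trans (h.bound p hp).1
  exact nonneg_of_mul_nonneg_right h1 h.M_pos

lemma norm_sq (h : Setup C r₀ w m z e c s M) (d : E3) :
    ‖d‖ ^ 2 = ⟪d, w⟫ ^ 2 + ⟪d, m⟫ ^ 2 + ⟪d, z⟫ ^ 2 := by
  rw [← real_inner_self_eq_norm_sq, h.dec]; ring

lemma eq_of_height_zero (h : Setup C r₀ w m z e c s M) {p : E3} (hp : p ∈ C)
    (h0 : ⟪p - r₀, e⟫ = 0) (n : E3) : ⟪p - r₀, n⟫ = ⟪p - r₀, z⟫ * ⟪n, z⟫ := by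
  have h1 := h.bound p hp
  rw [h0, neg_zero, mul_zero] at h1
  have h2 := abs_nonpos_iff.mp h1.1
  have h3 := abs_nonpos_iff.mp h1.2
  rw [h.dec, h2, h3]; ring

end Setup

lemma compact_min {X : Type*} [TopologicalSpace X] {K : Set X} (hK : IsCompact K) {f : X → ℝ}
    (hf : Continuous f) (h : ∀ x ∈ K, 0 < f x) : ∃ t₀ > 0, ∀ x ∈ K, t₀ ≤ f x := by
  rcases K.eq_empty_or_nonempty with rfl | hne
  · exact ⟨1, one_pos, by simp⟩
  · obtain ⟨x, hx, hmin⟩ := hK.exists_isMinOn hne hf.continuousOn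
    exact ⟨f x, h x hx, fun y hy => hmin hy⟩

lemma normal_at_zero {C : Set E3} {r₀ w m z e : E3} {c s M : ℝ} (h : Setup C r₀ w m z e c s M)
    {n : E3} (hn : IsOutwardNormalAt C r₀ n) :
    0 < ⟪n, m⟫ ∧ c * |⟪n, w⟫| ≤ s * ⟪n, m⟫ ∧ ⟪n, z⟫ = 0 := by
  obtain ⟨h1, h2⟩ := h.normal n hn
  have h3 : 0 ≤ ⟪n, m⟫ := by
    have : 0 ≤ s * ⟪n, m⟫ := le_trans (mul_nonneg h.c_pos.le (abs_nonneg _)) h2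
    exact nonneg_of_mul_nonneg_right this h.s_pos
  refine ⟨lt_of_le_of_ne h3 ?_, h2, h1⟩
  intro h0
  rw [← h0, mul_zero] at h2
  have h4 : ⟪n, w⟫ = 0 := by
    have : |⟪n, w⟫| ≤ 0 := nonpos_of_mul_nonpos_right h2 h.c_pos
    exact abs_nonpos_iff.mp this
  have := h.norm_sq n
  rw [hn.1, h1, h4, ← h0] at this
  norm_num at this

lemma good_normals {C : Set E3} {r₀ w m z e : E3} {c s M : ℝ} (h : Setup C r₀ w m z e c s M)
    {a' b' η : ℝ} (hη : 0 < η)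
    (hb : ∀ x ∈ C, ⟪x - r₀, e⟫ = 0 → 0 < ⟪x - r₀, z⟫ → ⟪x - r₀, z⟫ ≤ b' →
      ∃ x' ∈ C, ⟪x' - r₀, e⟫ = 0 ∧ ⟪x - r₀, z⟫ < ⟪x' - r₀, z⟫)
    (ha : ∀ x ∈ C, ⟪x - r₀, e⟫ = 0 → 0 < ⟪x - r₀, -z⟫ → ⟪x - r₀, -z⟫ ≤ a' →
      ∃ x' ∈ C, ⟪x' - r₀, e⟫ = 0 ∧ ⟪x - r₀, -z⟫ < ⟪x' - r₀, -z⟫) :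
    ∃ t₀ > 0, ∀ p ∈ C, -⟪p - r₀, e⟫ < t₀ → ⟪p - r₀, z⟫ ≤ b' → ⟪p - r₀, -z⟫ ≤ a' →
      ∀ n, IsOutwardNormalAt C p n →
        0 < ⟪n, m⟫ ∧ c * |⟪n, w⟫| < (s + η) * ⟪n, m⟫ ∧ |⟪n, z⟫| < η * ⟪n, m⟫ := by
  set Z : Set (E3 × E3) := (C ×ˢ Metric.sphere (0 : E3) 1) ∩
    {q | (∀ x ∈ C, ⟪x - q.1, q.2⟫ ≤ 0) ∧ ⟪q.1 - r₀, z⟫ ≤ b' ∧ ⟪q.1 - r₀, -z⟫ ≤ a' ∧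
      ¬ (0 < ⟪q.2, m⟫ ∧ c * |⟪q.2, w⟫| < (s + η) * ⟪q.2, m⟫ ∧ |⟪q.2, z⟫| < η * ⟪q.2, m⟫)} with hZ
  have hZc : IsCompact Z := by
    refine (h.body.1.prod (isCompact_sphere _ _)).inter_right ?_
    have e1 : IsClosed {q : E3 × E3 | ∀ x ∈ C, ⟪x - q.1, q.2⟫ ≤ 0} := by
      simp only [Set.ofPred_forall]
      refine isClosed_biInter fun x hx => isClosed_le (by fun_prop) (by fun_prop)
    have e3 : IsClosed {q : E3 × E3 | ⟪q.1 - r₀, z⟫ ≤ b'} :=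
      isClosed_le (by fun_prop) (by fun_prop)
    have e4 : IsClosed {q : E3 × E3 | ⟪q.1 - r₀, -z⟫ ≤ a'} :=
      isClosed_le (by fun_prop) (by fun_prop)
    refine e1.inter (e3.inter (e4.inter ?_))
    have o1 : IsOpen {q : E3 × E3 | 0 < ⟪q.2, m⟫} := isOpen_lt (by fun_prop) (by fun_prop)
    have o2 : IsOpen {q : E3 × E3 | c * |⟪q.2, w⟫| < (s + η) * ⟪q.2, m⟫} :=
      isOpen_lt (by fun_prop) (by fun_prop)
    have o3 : IsOpen {q : E3 × E3 | |⟪q.2, z⟫| < η * ⟪q.2, m⟫} :=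
      isOpen_lt (by fun_prop) (by fun_prop)
    have e2 := o1.inter (o2.inter o3)
    exact e2.isClosed_compl
  obtain ⟨t₀, ht₀, hmin⟩ := compact_min hZc (f := fun q => -⟪q.1 - r₀, e⟫) (by fun_prop) (by
    rintro ⟨p, n⟩ ⟨⟨hp, hn1⟩, hn2, h3, h4, h5⟩
    simp only [mem_sphere_iff_norm, sub_zero] at hp hn1 hn2 h3 h4 h5 ⊢
    refine lt_of_le_of_ne (h.height_nonneg hp) ?_
    intro h0
    have h0' : ⟪p - r₀, e⟫ = 0 := by linarith
    apply h5
    -- n is normal at r₀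
    have key : ⟪p - r₀, n⟫ = 0 := by
      have hr : ⟪r₀ - p, n⟫ ≤ 0 := hn2 r₀ h.mem
      have hr' : 0 ≤ ⟪p - r₀, n⟫ := by
        rw [← neg_sub, inner_neg_left] at hr; linarith
      rw [h.eq_of_height_zero hp h0' n] at hr' ⊢
      have hx' : ∀ x' ∈ C, ⟪x' - r₀, e⟫ = 0 →
          (⟪x' - r₀, z⟫ - ⟪p - r₀, z⟫) * ⟪n, z⟫ ≤ 0 := by
        intro x' hx' hx0
        have h6 := hn2 x' hx'
        have h7 : ⟪x' - p, n⟫ = ⟪x' - r₀, n⟫ - ⟪p - r₀, n⟫ := by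
          rw [← inner_sub_left]; congr 1; abel
        rw [h7, h.eq_of_height_zero hp h0' n, h.eq_of_height_zero hx' hx0 n] at h6
        linarith
      rcases lt_trichotomy ⟪p - r₀, z⟫ 0 with hlt | heq | hgt
      · obtain ⟨x', hxC, hx0, hxl⟩ := ha p hp h0' (by rw [inner_neg_right]; linarith) h4
        rw [inner_neg_right, inner_neg_right] at hxl
        have h8 := hx' x' hxC hx0
        have h9 : 0 ≤ ⟪n, z⟫ := by
          by_contra hc; push Not at hc; nlinarith
        have h10 : ⟪n, z⟫ ≤ 0 := by
          by_contra hc; push Not at hc; nlinarith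
        rw [le_antisymm h10 h9, mul_zero]
      · rw [heq, zero_mul]
      · obtain ⟨x', hxC, hx0, hxl⟩ := hb p hp h0' hgt h3
        have h8 := hx' x' hxC hx0
        have h9 : 0 ≤ ⟪n, z⟫ := by
          by_contra hc; push Not at hc; nlinarith
        have h10 : ⟪n, z⟫ ≤ 0 := by
          by_contra hc; push Not at hc; nlinarith
        rw [le_antisymm h10 h9, mul_zero]
    have hnr : IsOutwardNormalAt C r₀ n := by
      refine ⟨hn1, fun x hx => ?_⟩
      have h6 := hn2 x hx
      have h7 : ⟪x - r₀, n⟫ = ⟪x - p, n⟫ + ⟪p - r₀, n⟫ := by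
        rw [← inner_add_left]; congr 1; abel
      linarith
    obtain ⟨g1, g2, g3⟩ := normal_at_zero h hnr
    refine ⟨g1, ?_, ?_⟩
    · nlinarith [mul_pos hη g1]
    · rw [g3, abs_zero]; positivity)
  refine ⟨t₀, ht₀, fun p hp hlt h1 h2 n hn => ?_⟩
  by_contra hcon
  have := hmin (p, n) ⟨⟨hp, by simpa using hn.1⟩, hn.2, h1, h2, hcon⟩
  simp only at this
  linarith

def proj2 (f g : E3) (p : E3) : E2 := !₂[⟪p, f⟫, ⟪p, g⟫]

lemma dist_E2_sq (x y : E2) : dist x y ^ 2 = (x 0 - y 0) ^ 2 + (x 1 - y 1) ^ 2 := by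
  rw [EuclideanSpace.dist_eq, Real.sq_sqrt (by positivity), Fin.sum_univ_two]
  simp [Real.dist_eq, sq_abs]

lemma meas_proj_le {C : Set E3} {r₀ w m z e : E3} {c s M : ℝ} (h : Setup C r₀ w m z e c s M)
    (X : Set E3) : μH[2] (proj2 w z '' X) ≤ μH[2] X := by
  have h1 : LipschitzWith 1 (proj2 w z) := by
    refine LipschitzWith.of_dist_le_mul fun x y => ?_
    rw [NNReal.coe_one, one_mul]
    refine abs_le_of_sq_le_sq' ?_ dist_nonneg |>.2
    rw [dist_E2_sq, dist_eq_norm, h.norm_sq]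
    simp only [proj2, inner_sub_left]
    simp
    positivity
  simpa using h1.hausdorffMeasure_image_le (d := 2) (by norm_num) X

lemma good_measure {C : Set E3} {r₀ w m z e : E3} {c s M : ℝ} (h : Setup C r₀ w m z e c s M)
    {a' b' η t₀ t : ℝ} (hη : 0 < η) (hη1 : η ≤ 1) (htt : t < t₀)
    (hn : ∀ p ∈ C, -⟪p - r₀, e⟫ < t₀ → ⟪p - r₀, z⟫ ≤ b' → ⟪p - r₀, -z⟫ ≤ a' →
      ∀ n, IsOutwardNormalAt C p n →
        0 < ⟪n, m⟫ ∧ c * |⟪n, w⟫| < (s + η) * ⟪n, m⟫ ∧ |⟪n, z⟫| < η * ⟪n, m⟫) :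
    μH[2] (Sset C r₀ e t ∩ {p | ⟪p - r₀, z⟫ ≤ b' ∧ ⟪p - r₀, -z⟫ ≤ a'}) ≤
      ENNReal.ofReal ((1 + 5 * η / c ^ 2) * (1 / c)) * μH[2] (Bset C r₀ e t) := by
  have hc := h.c_pos
  have hs1 : s ≤ 1 := by nlinarith [h.cs, h.s_pos]
  set G := Sset C r₀ e t ∩ {p | ⟪p - r₀, z⟫ ≤ b' ∧ ⟪p - r₀, -z⟫ ≤ a'} with hG
  have hGC : ∀ p ∈ G, p ∈ C := fun p hp => h.body.1.isClosed.frontier_subset hp.1.1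
  have hGh : ∀ p ∈ G, -⟪p - r₀, e⟫ ≤ t := fun p hp => by
    have : ⟪p - r₀, e⟫ ≥ -t := hp.1.2
    linarith
  have hGn : ∀ p ∈ G, ∃ n, IsOutwardNormalAt C p n := by
    intro p hp
    obtain ⟨n, hn, -⟩ := exists_normal h.body (v := 0) (hGC p hp) (fun σ _ => by
      simpa using hp.1.1.2)
    exact ⟨n, hn⟩
  -- one sided estimate
  have one : ∀ p ∈ G, ∀ q ∈ G, c * ⟪q - p, m⟫ ≤
      s * |⟪q - p, w⟫| + η * (|⟪q - p, w⟫| + |⟪q - p, z⟫|) := by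
    intro p hp q hq
    obtain ⟨n, hnn⟩ := hGn p hp
    obtain ⟨g1, g2, g3⟩ := hn p (hGC p hp) (lt_of_le_of_lt (hGh p hp) htt) hp.2.1 hp.2.2 n hnn
    have g4 := hnn.2 q (hGC q hq)
    rw [h.dec] at g4
    have g5 := neg_abs_le (⟪q - p, w⟫ * ⟪n, w⟫)
    have g6 := neg_abs_le (⟪q - p, z⟫ * ⟪n, z⟫)
    rw [abs_mul] at g5 g6
    have g7 := mul_le_mul_of_nonneg_left g2.le (abs_nonneg ⟪q - p, w⟫)
    have g8 := mul_le_mul_of_nonneg_left g3.le (abs_nonneg ⟪q - p, z⟫)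
    have hc1 : c ≤ 1 := by nlinarith [h.cs, h.s_pos]
    have g9 : c * (⟪q - p, m⟫ * ⟪n, m⟫) ≤
        |⟪q - p, w⟫| * ((s + η) * ⟪n, m⟫) + c * (|⟪q - p, z⟫| * (η * ⟪n, m⟫)) := by
      have := mul_le_mul_of_nonneg_left g8 hc.le
      have : ⟪q - p, m⟫ * ⟪n, m⟫ ≤ |⟪q - p, w⟫| * |⟪n, w⟫| + |⟪q - p, z⟫| * |⟪n, z⟫| := by
        linarith
      have := mul_le_mul_of_nonneg_left this hc.le
      linarith
    have g10 : c * (|⟪q - p, z⟫| * (η * ⟪n, m⟫)) ≤ |⟪q - p, z⟫| * (η * ⟪n, m⟫) :=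
      mul_le_of_le_one_left (by positivity) hc1
    refine le_of_mul_le_mul_right ?_ g1
    linarith
  have hK : 0 ≤ 1 + 5 * η / c ^ 2 := by positivity
  have hanti := meas_le_of_antilip (s := G) (f := fun p => scaleMap (1 / c) (proj2 w z p))
    (NNReal.sqrt (Real.toNNReal (1 + 5 * η / c ^ 2))) (by
    intro p hp q hq
    refine abs_le_of_sq_le_sq' ?_ (by positivity) |>.2
    have e1 := one p hp q hq
    have e2 := one q hq p hp
    rw [mul_pow, dist_E2_sq, dist_comm, dist_eq_norm, h.norm_sq]
    have hsq : ((NNReal.sqrt (Real.toNNReal (1 + 5 * η / c ^ 2)) : NNReal) : ℝ) ^ 2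
        = 1 + 5 * η / c ^ 2 := by
      rw [← NNReal.coe_pow, NNReal.sq_sqrt, Real.coe_toNNReal _ hK]
    rw [hsq]
    have i1 : ∀ f : E3, ⟪p - q, f⟫ = - ⟪q - p, f⟫ := fun f => by
      rw [← neg_sub, inner_neg_left]
    rw [i1, i1, i1, abs_neg, abs_neg] at e2
    have i2 : ∀ f : E3, ⟪p, f⟫ = ⟪q, f⟫ - ⟪q - p, f⟫ := fun f => by
      rw [inner_sub_left]; ring
    simp only [scaleMap_apply, proj2]
    simp only [Matrix.cons_val_zero, Matrix.cons_val_one]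
    rw [i2 w, i2 z]
    generalize ⟪q - p, w⟫ = x at *
    generalize ⟪q - p, m⟫ = v at *
    generalize ⟪q - p, z⟫ = y at *
    have f1 : (c * v) ^ 2 ≤ (s * |x| + η * (|x| + |y|)) ^ 2 := by
      apply sq_le_sq'
      · linarith
      · linarith
    have f2 : (s * |x| + η * (|x| + |y|)) ^ 2 ≤ s ^ 2 * x ^ 2 + 5 * η * (x ^ 2 + y ^ 2) := by
      rw [← sq_abs x, ← sq_abs y]
      have hx := abs_nonneg x
      have hy := abs_nonneg y
      generalize |x| = x at *
      generalize |y| = y at *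
      have j1 : s * (x * (x + y)) ≤ x * (x + y) := mul_le_of_le_one_left (by positivity) hs1
      have j2 : η * (x + y) ^ 2 ≤ (x + y) ^ 2 := mul_le_of_le_one_left (by positivity) hη1
      have j3 : 2 * (s * (x * (x + y))) + η * (x + y) ^ 2 ≤ 5 * (x ^ 2 + y ^ 2) := by
        nlinarith [sq_nonneg (x - y)]
      have := mul_le_mul_of_nonneg_left j3 hη.le
      nlinarith
    have f3 : c ^ 2 * (x ^ 2 + v ^ 2 + y ^ 2) ≤ x ^ 2 + c ^ 2 * y ^ 2 + 5 * η * (x ^ 2 + y ^ 2) := by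
      have := h.cs
      have j : c ^ 2 * x ^ 2 + s ^ 2 * x ^ 2 = x ^ 2 := by rw [← add_mul, this, one_mul]
      nlinarith
    have hc2 : 0 < c ^ 2 := by positivity
    have hc1 : c ^ 2 ≤ 1 := by nlinarith [h.cs, h.s_pos]
    have f4 : x ^ 2 ≤ x ^ 2 / c ^ 2 := by
      rw [le_div_iff₀ hc2]; nlinarith [sq_nonneg x]
    have f5 : x ^ 2 + v ^ 2 + y ^ 2 ≤ x ^ 2 / c ^ 2 + y ^ 2 + 5 * η / c ^ 2 * (x ^ 2 + y ^ 2) := by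
      have : x ^ 2 / c ^ 2 + y ^ 2 + 5 * η / c ^ 2 * (x ^ 2 + y ^ 2) =
        (x ^ 2 + c ^ 2 * y ^ 2 + 5 * η * (x ^ 2 + y ^ 2)) / c ^ 2 := by field_simp
      rw [this, le_div_iff₀ hc2]; linarith
    have f6 : 5 * η / c ^ 2 * (x ^ 2 + y ^ 2) ≤ 5 * η / c ^ 2 * (x ^ 2 / c ^ 2 + y ^ 2) := by
      gcongr
    have f7 : (1 / c * (⟪q, w⟫ - x) - 1 / c * ⟪q, w⟫) ^ 2 + (⟪q, z⟫ - y - ⟪q, z⟫) ^ 2 =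
      x ^ 2 / c ^ 2 + y ^ 2 := by field_simp; ring
    rw [f7]
    linarith)
  have hsub : (fun p => scaleMap (1 / c) (proj2 w z p)) '' G ⊆
      scaleMap (1 / c) '' (proj2 w z '' (Bset C r₀ e t)) := by
    rintro _ ⟨p, hp, rfl⟩
    suffices ∃ q ∈ Bset C r₀ e t, proj2 w z q = proj2 w z p by
      obtain ⟨q, hq, hqp⟩ := this
      exact ⟨_, ⟨q, hq, rfl⟩, by rw [hqp]⟩
    -- move down in direction `-m`
    set κ := ⟪e, m⟫ with hκ
    have hκpos : 0 < κ := h.em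
    set T := (t - (-⟪p - r₀, e⟫)) / κ with hT
    have hT0 : 0 ≤ T := div_nonneg (by linarith [hGh p hp]) hκpos.le
    have hin : ∀ σ : ℝ, -⟪p - σ • m - r₀, e⟫ = -⟪p - r₀, e⟫ + σ * κ := by
      intro σ
      have : p - σ • m - r₀ = (p - r₀) - σ • m := by abel
      rw [this, inner_sub_left, real_inner_smul_left, hκ, real_inner_comm m e]; ring
    have hw : ∀ σ : ℝ, ⟪p - σ • m, w⟫ = ⟪p, w⟫ := by
      intro σ
      rw [inner_sub_left, real_inner_smul_left, real_inner_comm, real_inner_comm w m, h.wm]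
      rw [real_inner_comm]; ring
    have hz : ∀ σ : ℝ, ⟪p - σ • m, z⟫ = ⟪p, z⟫ := by
      intro σ
      rw [inner_sub_left, real_inner_smul_left, h.mz]; ring
    have hcmp : IsCompact (Icc 0 T ∩ (fun σ : ℝ => p - σ • m) ⁻¹' C) :=
      isCompact_Icc.inter_right (h.body.1.isClosed.preimage (by fun_prop))
    obtain ⟨σ, ⟨⟨hσ0, hσT⟩, hσC⟩, hmax⟩ := hcmp.exists_isMaxOn
      ⟨0, ⟨le_rfl, hT0⟩, by simpa using hGC p hp⟩ continuousOn_id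
    have hσC' : p - σ • m ∈ C := hσC
    have hTeq : T * κ = t - (-⟪p - r₀, e⟫) := by rw [hT]; field_simp
    have hσeq : σ = T := by
      by_contra hne
      have hlt : σ < T := lt_of_le_of_ne hσT hne
      obtain ⟨n, hnn, hnm⟩ := exists_normal h.body (v := -m) hσC' (by
        intro τ hτ hint
        have hτC := interior_subset hint
        set τ' := min τ (T - σ) with hτ'
        have hτpos : 0 < τ' := lt_min hτ (by linarith)
        have hmem : p - (σ + τ') • m ∈ C := by
          have hseg := h.body.2.1.add_smul_sub_mem hσC' hτC
            (t := τ' / τ) ⟨by positivity, (div_le_one hτ).2 (min_le_left _ _)⟩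
          have : p - σ • m + (τ' / τ) • (p - σ • m + τ • -m - (p - σ • m)) =
              p - (σ + τ') • m := by
            rw [add_sub_cancel_left, smul_smul, div_mul_cancel₀ _ hτ.ne', smul_neg, add_smul]
            abel
          rwa [this] at hseg
        have := hmax ⟨⟨by linarith, by linarith [min_le_right τ (T - σ)]⟩, hmem⟩
        simp only [id, mem_ofPred_eq] at this
        linarith)
      have g := hn (p - σ • m) hσC' (by
          rw [hin]
          have : σ * κ ≤ T * κ := mul_le_mul_of_nonneg_right hσT hκpos.le
          linarith)
        (by have := hp.2.1
            rw [inner_sub_left] at this ⊢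
            rw [hz]; exact this)
        (by have := hp.2.2
            rw [inner_neg_right, inner_sub_left] at this ⊢
            rw [hz]; exact this) n hnn
      rw [inner_neg_left, real_inner_comm] at hnm
      linarith [g.1]
    refine ⟨p - σ • m, ⟨hσC', ?_⟩, ?_⟩
    · have := hin σ
      rw [hσeq, hTeq] at this
      show ⟪p - σ • m - r₀, e⟫ = -t
      rw [hσeq]; linarith
    · simp only [proj2, hw, hz]
  refine hanti.trans ?_
  have hsqe : ((NNReal.sqrt (Real.toNNReal (1 + 5 * η / c ^ 2)) : NNReal) : ℝ≥0∞) ^ (2:ℝ) =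
      ENNReal.ofReal (1 + 5 * η / c ^ 2) := by
    rw [ENNReal.rpow_two, ← ENNReal.coe_pow, NNReal.sq_sqrt]; rfl
  rw [hsqe, ENNReal.ofReal_mul hK, mul_assoc]
  gcongr
  refine (measure_mono hsub).trans ?_
  rw [meas_scaleMap _ (by positivity)]
  gcongr
  exact meas_proj_le h _

lemma bad_piece {C : Set E3} {r₀ f₁ f₂ f₃ : E3}
    (dec : ∀ x y : E3, ⟪x, y⟫ = ⟪x, f₁⟫ * ⟪y, f₁⟫ + ⟪x, f₂⟫ * ⟪y, f₂⟫ + ⟪x, f₃⟫ * ⟪y, f₃⟫)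
    {k : NNReal} (hk : ∀ a b c d : ℝ, a ≤ b → c ≤ d →
    μH[2] {q : E2 | (a ≤ q 0 ∧ q 0 ≤ b) ∧ (c ≤ q 1 ∧ q 1 ≤ d)} =
      k * ENNReal.ofReal ((b - a) * (d - c)))
    {S : Set E3} (hSC : S ⊆ C)
    (hn : ∀ p ∈ S, ∃ n, IsOutwardNormalAt C p n ∧ 1 / 2 ≤ ⟪n, f₃⟫)
    {α β c₁ c₂ : ℝ} (hα : 0 ≤ α) (hβ : 0 ≤ β)
    (h1 : ∀ p ∈ S, |⟪p - r₀, f₁⟫ - c₁| ≤ α) (h2 : ∀ p ∈ S, |⟪p - r₀, f₂⟫ - c₂| ≤ β) :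
    μH[2] S ≤ k * ENNReal.ofReal (36 * (α * β)) := by
  have one : ∀ p ∈ S, ∀ q ∈ S, ⟪q - p, f₃⟫ ≤ 2 * (|⟪q - p, f₁⟫| + |⟪q - p, f₂⟫|) := by
    intro p hp q hq
    obtain ⟨n, hnn, hn3⟩ := hn p hp
    have g4 := hnn.2 q (hSC hq)
    have g0 := dec n n
    rw [real_inner_self_eq_norm_sq, hnn.1] at g0
    rw [dec] at g4
    have b1 : |⟪n, f₁⟫| ≤ 1 := abs_le_one_iff_mul_self_le_one.mpr
      (by nlinarith [mul_self_nonneg ⟪n, f₂⟫, mul_self_nonneg ⟪n, f₃⟫])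
    have b2 : |⟪n, f₂⟫| ≤ 1 := abs_le_one_iff_mul_self_le_one.mpr
      (by nlinarith [mul_self_nonneg ⟪n, f₁⟫, mul_self_nonneg ⟪n, f₃⟫])
    have g5 := neg_abs_le (⟪q - p, f₁⟫ * ⟪n, f₁⟫)
    have g6 := neg_abs_le (⟪q - p, f₂⟫ * ⟪n, f₂⟫)
    rw [abs_mul] at g5 g6
    have g7 := mul_le_of_le_one_right (abs_nonneg ⟪q - p, f₁⟫) b1
    have g8 := mul_le_of_le_one_right (abs_nonneg ⟪q - p, f₂⟫) b2
    by_contra hcon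
    push Not at hcon
    have := abs_nonneg ⟪q - p, f₁⟫
    have := abs_nonneg ⟪q - p, f₂⟫
    nlinarith
  have hanti := meas_le_of_antilip (s := S) (f := fun p => proj2 f₁ f₂ p) 3 (by
    intro p hp q hq
    refine abs_le_of_sq_le_sq' ?_ (by positivity) |>.2
    have e1 := one p hp q hq
    have e2 := one q hq p hp
    rw [mul_pow, dist_E2_sq, dist_comm, dist_eq_norm, ← real_inner_self_eq_norm_sq, dec]
    have i1 : ∀ f : E3, ⟪p - q, f⟫ = - ⟪q - p, f⟫ := fun f => by
      rw [← neg_sub, inner_neg_left]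
    rw [i1, i1, i1, abs_neg, abs_neg] at e2
    have i2 : ∀ f : E3, ⟪p, f⟫ = ⟪q, f⟫ - ⟪q - p, f⟫ := fun f => by
      rw [inner_sub_left]; ring
    simp only [proj2]
    simp only [Matrix.cons_val_zero, Matrix.cons_val_one]
    rw [i2 f₁, i2 f₂]
    generalize ⟪q - p, f₁⟫ = x at *
    generalize ⟪q - p, f₃⟫ = v at *
    generalize ⟪q - p, f₂⟫ = y at *
    have f1 : v ^ 2 ≤ (2 * (|x| + |y|)) ^ 2 := by
      apply sq_le_sq' <;> linarith
    have f2 : (2 * (|x| + |y|)) ^ 2 ≤ 8 * (x ^ 2 + y ^ 2) := by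
      rw [← sq_abs x, ← sq_abs y]
      nlinarith [sq_nonneg (|x| - |y|)]
    push_cast
    nlinarith)
  refine hanti.trans ?_
  have hsub : (fun p => proj2 f₁ f₂ p) '' S ⊆
      {q : E2 | (⟪r₀, f₁⟫ + c₁ - α ≤ q 0 ∧ q 0 ≤ ⟪r₀, f₁⟫ + c₁ + α) ∧
        (⟪r₀, f₂⟫ + c₂ - β ≤ q 1 ∧ q 1 ≤ ⟪r₀, f₂⟫ + c₂ + β)} := by
    rintro _ ⟨p, hp, rfl⟩
    have j1 := abs_le.mp (h1 p hp)
    have j2 := abs_le.mp (h2 p hp)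
    rw [inner_sub_left] at j1 j2
    simp only [proj2, mem_ofPred_eq, Matrix.cons_val_zero, Matrix.cons_val_one]
    refine ⟨⟨?_, ?_⟩, ?_, ?_⟩ <;> linarith
  calc ((3 : NNReal) : ℝ≥0∞) ^ (2:ℝ) * μH[2] ((fun p => proj2 f₁ f₂ p) '' S)
      ≤ ENNReal.ofReal 9 * (k * ENNReal.ofReal ((2 * α) * (2 * β))) := by
        have : ((3 : NNReal) : ℝ≥0∞) ^ (2:ℝ) = ENNReal.ofReal 9 := by
          rw [ENNReal.rpow_two]; norm_num
        rw [this]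
        gcongr
        refine (measure_mono hsub).trans_eq ?_
        rw [hk _ _ _ _ (by linarith) (by linarith)]
        congr 2; ring
    _ = k * ENNReal.ofReal (36 * (α * β)) := by
        rw [mul_left_comm, ← ENNReal.ofReal_mul (by norm_num)]
        congr 2; ring

lemma bad_measure {C : Set E3} {r₀ w m z e : E3} {c s M : ℝ} (h : Setup C r₀ w m z e c s M)
    {k : NNReal} (hk : ∀ a b c d : ℝ, a ≤ b → c ≤ d →
    μH[2] {q : E2 | (a ≤ q 0 ∧ q 0 ≤ b) ∧ (c ≤ q 1 ∧ q 1 ≤ d)} =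
      k * ENNReal.ofReal ((b - a) * (d - c)))
    {S : Set E3} {t δ b : ℝ} (ht : 0 ≤ t) (hδ : 0 ≤ δ) (hS : S ⊆ Sset C r₀ e t)
    (hz : ∀ p ∈ S, |⟪p - r₀, z⟫ - b| ≤ δ) (htδ : M * t ≤ δ) :
    μH[2] S ≤ k * ENNReal.ofReal (216 * (M * t * δ)) := by
  have hMt : 0 ≤ M * t := mul_nonneg h.M_pos.le ht
  have hSC : S ⊆ C := fun p hp => h.body.1.isClosed.frontier_subset (hS hp).1
  have hh : ∀ p ∈ S, -⟪p - r₀, e⟫ ≤ t := fun p hp => by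
    have : ⟪p - r₀, e⟫ ≥ -t := (hS hp).2
    linarith
  have hw : ∀ p ∈ S, |⟪p - r₀, w⟫ - 0| ≤ M * t := fun p hp => by
    rw [sub_zero]
    exact (h.bound p (hSC hp)).1.trans (mul_le_mul_of_nonneg_left (hh p hp) h.M_pos.le)
  have hm : ∀ p ∈ S, |⟪p - r₀, m⟫ - 0| ≤ M * t := fun p hp => by
    rw [sub_zero]
    exact (h.bound p (hSC hp)).2.trans (mul_le_mul_of_nonneg_left (hh p hp) h.M_pos.le)
  let P : E3 → Set E3 := fun f => {p ∈ S | ∃ n, IsOutwardNormalAt C p n ∧ 1 / 2 ≤ ⟪n, f⟫}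
  have hPS : ∀ f, P f ⊆ S := fun f p hp => hp.1
  have dec := h.dec
  have neg_dec : ∀ f x y : E3, ⟪x, -f⟫ * ⟪y, -f⟫ = ⟪x, f⟫ * ⟪y, f⟫ := fun f x y => by
    rw [inner_neg_right, inner_neg_right, neg_mul_neg]
  have pw : ∀ f, (f = w ∨ f = -w) → μH[2] (P f) ≤ k * ENNReal.ofReal (36 * (M * t * δ)) := by
    intro f hf
    refine bad_piece (C := C) (r₀ := r₀) (f₁ := m) (f₂ := z) (f₃ := f) ?_ hk
      ((hPS f).trans hSC) (fun p hp => hp.2) hMt hδ (fun p hp => hm p hp.1)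
      (fun p hp => hz p hp.1)
    intro x y
    rcases hf with rfl | rfl
    · rw [dec]; ring
    · rw [dec, neg_dec]; ring
  have pm : ∀ f, (f = m ∨ f = -m) → μH[2] (P f) ≤ k * ENNReal.ofReal (36 * (M * t * δ)) := by
    intro f hf
    refine bad_piece (C := C) (r₀ := r₀) (f₁ := w) (f₂ := z) (f₃ := f) ?_ hk
      ((hPS f).trans hSC) (fun p hp => hp.2) hMt hδ (fun p hp => hw p hp.1)
      (fun p hp => hz p hp.1)
    intro x y
    rcases hf with rfl | rfl
    · rw [dec]; ring
    · rw [dec, neg_dec]; ring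
  have pz : ∀ f, (f = z ∨ f = -z) → μH[2] (P f) ≤ k * ENNReal.ofReal (36 * (M * t * δ)) := by
    intro f hf
    refine (bad_piece (C := C) (r₀ := r₀) (f₁ := w) (f₂ := m) (f₃ := f) ?_ hk
      ((hPS f).trans hSC) (fun p hp => hp.2) hMt hMt (fun p hp => hw p hp.1)
      (fun p hp => hm p hp.1)).trans ?_
    · intro x y
      rcases hf with rfl | rfl
      · rw [dec]
      · rw [dec, neg_dec]
    · gcongr
  have hcov : S ⊆ (((P w ∪ P (-w)) ∪ (P m ∪ P (-m))) ∪ (P z ∪ P (-z))) := by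
    intro p hp
    obtain ⟨n, hn, -⟩ := exists_normal h.body (v := 0) (hSC hp) (fun σ _ => by
      simpa using (hS hp).1.2)
    have hP : ∀ f, 1 / 2 ≤ ⟪n, f⟫ → p ∈ P f := fun f hf => ⟨hp, n, hn, hf⟩
    have hP' : ∀ f, 1 / 2 ≤ |⟪n, f⟫| → p ∈ P f ∪ P (-f) := by
      intro f hf
      rcases le_abs.mp hf with h' | h'
      · exact Or.inl (hP f h')
      · exact Or.inr (hP (-f) (by rwa [inner_neg_right]))
    by_cases c1 : 1 / 2 ≤ |⟪n, w⟫|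
    · exact Or.inl (Or.inl (hP' _ c1))
    by_cases c2 : 1 / 2 ≤ |⟪n, m⟫|
    · exact Or.inl (Or.inr (hP' _ c2))
    by_cases c3 : 1 / 2 ≤ |⟪n, z⟫|
    · exact Or.inr (hP' _ c3)
    exfalso
    push Not at c1 c2 c3
    have := h.norm_sq n
    rw [hn.1, ← sq_abs ⟪n, w⟫, ← sq_abs ⟪n, m⟫, ← sq_abs ⟪n, z⟫] at this
    nlinarith [abs_nonneg ⟪n, w⟫, abs_nonneg ⟪n, m⟫, abs_nonneg ⟪n, z⟫]
  set R := (k : ℝ≥0∞) * ENNReal.ofReal (36 * (M * t * δ)) with hR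
  calc μH[2] S ≤ ((R + R) + (R + R)) + (R + R) := by
        refine (measure_mono hcov).trans ?_
        refine (measure_union_le _ _).trans (add_le_add ((measure_union_le _ _).trans (add_le_add
          ((measure_union_le _ _).trans ?_) ((measure_union_le _ _).trans ?_)))
          ((measure_union_le _ _).trans ?_))
        · exact add_le_add (pw _ (Or.inl rfl)) (pw _ (Or.inr rfl))
        · exact add_le_add (pm _ (Or.inl rfl)) (pm _ (Or.inr rfl))
        · exact add_le_add (pz _ (Or.inl rfl)) (pz _ (Or.inr rfl))
    _ = ENNReal.ofReal 6 * R := by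
        have : ENNReal.ofReal 6 = 6 := by norm_num
        rw [this]; ring
    _ = k * ENNReal.ofReal (216 * (M * t * δ)) := by
        rw [hR, mul_left_comm, ← ENNReal.ofReal_mul (by norm_num)]
        congr 2; ring

lemma lower_measure {C : Set E3} {r₀ w m z e : E3} {c s M : ℝ} (h : Setup C r₀ w m z e c s M)
    {k : NNReal} (hk : ∀ a b c d : ℝ, a ≤ b → c ≤ d →
    μH[2] {q : E2 | (a ≤ q 0 ∧ q 0 ≤ b) ∧ (c ≤ q 1 ∧ q 1 ≤ d)} =
      k * ENNReal.ofReal ((b - a) * (d - c)))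
    {x : E3} (hx : x ∈ C) (hx0 : ⟪x - r₀, e⟫ = 0) (hxz : 0 < ⟪x - r₀, z⟫) :
    ∃ c₀ > 0, ∃ t₁ > 0, ∀ t, 0 < t → t < t₁ →
      k * ENNReal.ofReal (c₀ * t) ≤ μH[2] (Bset C r₀ e t) := by
  obtain ⟨p₀, hp₀⟩ := h.body.2.2
  obtain ⟨ρ, hρ, hball⟩ := Metric.isOpen_iff.mp isOpen_interior p₀ hp₀
  have hballC : ∀ y, dist y p₀ < ρ → y ∈ C := fun y hy => interior_subset (hball hy)
  set κ := ⟪e, m⟫ with hκ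
  have hκpos : 0 < κ := h.em
  -- tangential direction
  set τ : E3 := κ • w - ⟪e, w⟫ • m with hτ
  have mw : ⟪m, w⟫ = 0 := by rw [real_inner_comm]; exact h.wm
  have zw : ⟪z, w⟫ = 0 := by rw [real_inner_comm]; exact h.wz
  have hτw : ⟪τ, w⟫ = κ := by
    rw [hτ, inner_sub_left, real_inner_smul_left, real_inner_smul_left, h.ww, mw]; ring
  have hτz : ⟪τ, z⟫ = 0 := by
    rw [hτ, inner_sub_left, real_inner_smul_left, real_inner_smul_left, h.wz, h.mz]; ring
  have hτe : ⟪τ, e⟫ = 0 := by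
    rw [hτ, inner_sub_left, real_inner_smul_left, real_inner_smul_left, real_inner_comm e w,
      real_inner_comm e m]; ring
  obtain ⟨ρ', hρ', hρτ⟩ : ∃ ρ' > 0, ρ' * ‖τ‖ < ρ := by
    refine ⟨ρ / (‖τ‖ + 1), by positivity, ?_⟩
    rw [div_mul_eq_mul_div, div_lt_iff₀ (by positivity)]
    nlinarith [norm_nonneg τ]
  have hτC : ∀ a : ℝ, |a| ≤ ρ' → p₀ + a • τ ∈ C := by
    intro a ha
    apply hballC
    rw [dist_eq_norm, add_sub_cancel_left, norm_smul, Real.norm_eq_abs]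
    exact lt_of_le_of_lt (mul_le_mul_of_nonneg_right ha (norm_nonneg _)) hρτ
  set H := -⟪p₀ - r₀, e⟫ with hH
  have hHpos : 0 < H := by
    -- move up a little in direction `m`
    obtain ⟨a, ha, ham⟩ : ∃ a > 0, a * ‖m‖ < ρ := by
      refine ⟨ρ / (‖m‖ + 1), by positivity, ?_⟩
      rw [div_mul_eq_mul_div, div_lt_iff₀ (by positivity)]
      nlinarith [norm_nonneg m]
    have h1 : p₀ + a • m ∈ C := by
      apply hballC
      rw [dist_eq_norm, add_sub_cancel_left, norm_smul, Real.norm_eq_abs, abs_of_pos ha]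
      exact ham
    have h2 := h.height_nonneg h1
    have h3 : p₀ + a • m - r₀ = (p₀ - r₀) + a • m := by abel
    rw [h3, inner_add_left, real_inner_smul_left, real_inner_comm e m] at h2
    have : 0 < a * κ := by positivity
    linarith
  set b := ⟪x - r₀, z⟫ with hb
  have hxw : ⟪x - r₀, w⟫ = 0 := by rw [h.eq_of_height_zero hx hx0, h.wz, mul_zero]
  refine ⟨ρ' * κ * b / H, by positivity, H / 2, by positivity, ?_⟩
  intro t ht htH
  set l := t / H with hl
  have hlpos : 0 < l := by positivity
  have hl2 : l < 1 / 2 := by rw [hl, div_lt_iff₀ hHpos]; linarith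
  have hlH : l * H = t := by rw [hl]; field_simp
  refine le_trans ?_ (meas_proj_le h _)
  set x0 := ⟪r₀, w⟫ + l * ⟪p₀ - r₀, w⟫ with hx0'
  set y0 := ⟪r₀, z⟫ + l * ⟪p₀ - r₀, z⟫ with hy0'
  have hsub : {q : E2 | (x0 - l * (ρ' * κ) ≤ q 0 ∧ q 0 ≤ x0 + l * (ρ' * κ)) ∧
      (y0 ≤ q 1 ∧ q 1 ≤ y0 + (1 - l) * b)} ⊆ proj2 w z '' Bset C r₀ e t := by
    rintro q ⟨⟨q1, q2⟩, q3, q4⟩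
    set a := (q 0 - x0) / (l * κ) with ha
    set y := (q 1 - y0) / ((1 - l) * b) with hy
    have h1l : 0 < 1 - l := by linarith
    have haeq : l * (a * κ) = q 0 - x0 := by rw [ha]; field_simp
    have hyeq : (1 - l) * (y * b) = q 1 - y0 := by rw [hy]; field_simp
    have haρ : |a| ≤ ρ' := by
      rw [ha, abs_div, abs_of_pos (mul_pos hlpos hκpos), div_le_iff₀ (by positivity), abs_le]
      constructor <;> linarith
    have hy0 : 0 ≤ y := div_nonneg (by linarith) (by positivity)
    have hy1 : y ≤ 1 := by rw [hy, div_le_one (by positivity)]; linarith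
    have m1 : r₀ + y • (x - r₀) ∈ C := h.body.2.1.add_smul_sub_mem h.mem hx ⟨hy0, hy1⟩
    have m2 := hτC a haρ
    have m3 := h.body.2.1 m1 m2 h1l.le hlpos.le (by ring)
    have hsimp : ∀ f : E3, ⟪(1 - l) • (r₀ + y • (x - r₀)) + l • (p₀ + a • τ), f⟫ =
        ⟪r₀, f⟫ + (1 - l) * (y * ⟪x - r₀, f⟫) + l * ⟪p₀ - r₀, f⟫ + l * (a * ⟪τ, f⟫) := by
      intro f
      simp only [inner_add_left, real_inner_smul_left, inner_sub_left]
      ring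
    refine ⟨_, ⟨m3, ?_⟩, ?_⟩
    · show ⟪_ - r₀, e⟫ = -t
      rw [inner_sub_left, hsimp, hx0, hτe, ← hlH, hH]; ring
    · ext i
      fin_cases i
      · simp only [proj2, hsimp, hxw, hτw, haeq]
        simp [hx0']
      · simp only [proj2, hsimp, hτz, ← hb, hyeq]
        simp [hy0']
        ring
  refine le_trans ?_ (measure_mono hsub)
  have hlb : 0 ≤ (1 - l) * b := mul_nonneg (by linarith) hxz.le
  have hlk : 0 < l * (ρ' * κ) := by positivity
  rw [hk _ _ _ _ (by linarith) (by linarith)]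
  refine mul_le_mul' le_rfl (ENNReal.ofReal_le_ofReal ?_)
  have : ρ' * κ * b / H * t = l * (ρ' * κ) * b := by rw [hl]; field_simp
  rw [this]
  have : l * (ρ' * κ) * b > 0 := by positivity
  nlinarith

lemma top_part {C : Set E3} {r₀ w m z e : E3} {c s M : ℝ} (h : Setup C r₀ w m z e c s M)
    {μ : ℝ} (hμ : 0 < μ) :
    ∃ b' : ℝ, (∀ x ∈ C, ⟪x - r₀, e⟫ = 0 → 0 < ⟪x - r₀, z⟫ → ⟪x - r₀, z⟫ ≤ b' →
      ∃ x' ∈ C, ⟪x' - r₀, e⟫ = 0 ∧ ⟪x - r₀, z⟫ < ⟪x' - r₀, z⟫) ∧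
      ∃ t₀ > 0, ∀ t, 0 < t → t < t₀ → μH[2] (Sset C r₀ e t ∩ {p | b' < ⟪p - r₀, z⟫}) ≤
        ENNReal.ofReal μ * μH[2] (Bset C r₀ e t) := by
  obtain ⟨k, hkpos, hk⟩ := rect_meas
  have hFc : IsCompact (C ∩ {x | ⟪x - r₀, e⟫ = 0}) := by
    have : IsClosed {x : E3 | ⟪x - r₀, e⟫ = 0} := isClosed_eq (by fun_prop) (by fun_prop)
    exact h.body.1.inter_right this
  have hcont : Continuous fun x : E3 => ⟪x - r₀, z⟫ := by fun_prop
  obtain ⟨x, ⟨hxC, hx0⟩, hmax⟩ := hFc.exists_isMaxOn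
    ⟨r₀, h.mem, by simp⟩ hcont.continuousOn
  have hx0 : ⟪x - r₀, e⟫ = 0 := hx0
  have hmax' : ∀ y ∈ C, ⟪y - r₀, e⟫ = 0 → ⟪y - r₀, z⟫ ≤ ⟪x - r₀, z⟫ :=
    fun y hy hy0 => hmax ⟨hy, hy0⟩
  have hb0 : 0 ≤ ⟪x - r₀, z⟫ := by simpa using hmax' r₀ h.mem (by simp)
  set b := ⟪x - r₀, z⟫ with hb
  have hcut : ∀ δ > 0, ∃ t₀ > 0, ∀ p ∈ C, -⟪p - r₀, e⟫ < t₀ → ⟪p - r₀, z⟫ < b + δ := by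
    intro δ hδ
    have hcl : IsClosed {p : E3 | b + δ ≤ ⟪p - r₀, z⟫} := isClosed_le (by fun_prop) (by fun_prop)
    obtain ⟨t₀, ht₀, hmin⟩ := compact_min (h.body.1.inter_right hcl)
      (f := fun p => -⟪p - r₀, e⟫) (by fun_prop) (by
        rintro p ⟨hp, hpz⟩
        refine lt_of_le_of_ne (h.height_nonneg hp) fun h0 => ?_
        have := hmax' p hp (by linarith)
        have hpz : b + δ ≤ ⟪p - r₀, z⟫ := hpz
        linarith)
    refine ⟨t₀, ht₀, fun p hp hlt => ?_⟩
    by_contra hcon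
    push Not at hcon
    have := hmin p ⟨hp, hcon⟩
    linarith
  have hSC : ∀ t, ∀ p ∈ Sset C r₀ e t, p ∈ C ∧ -⟪p - r₀, e⟫ ≤ t := fun t p hp => by
    have : ⟪p - r₀, e⟫ ≥ -t := hp.2
    exact ⟨h.body.1.isClosed.frontier_subset hp.1, by linarith⟩
  rcases hb0.eq_or_lt with hb0 | hbpos
  · refine ⟨1, fun y hy hy0 hpos => ?_, ?_⟩
    · have := hmax' y hy hy0
      linarith
    · obtain ⟨t₀, ht₀, hh⟩ := hcut 1 one_pos
      refine ⟨t₀, ht₀, fun t ht htt => ?_⟩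
      have : Sset C r₀ e t ∩ {p | 1 < ⟪p - r₀, z⟫} = ∅ := by
        ext p
        simp only [mem_inter_iff, mem_empty_iff_false, iff_false, not_and]
        intro hp hpz
        have hpz : 1 < ⟪p - r₀, z⟫ := hpz
        have := hh p (hSC t p hp).1 (lt_of_le_of_lt (hSC t p hp).2 htt)
        linarith
      rw [this, measure_empty]
      exact bot_le
  · obtain ⟨c₀, hc₀, t₁, ht₁, hlow⟩ := lower_measure h hk hxC hx0 hbpos
    have hM := h.M_pos
    obtain ⟨δ, hδ, hδb, hδμ⟩ : ∃ δ > 0, δ < b ∧ 216 * (M * δ) ≤ μ * c₀ := by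
      refine ⟨min (b / 2) (μ * c₀ / (216 * M)), by positivity,
        lt_of_le_of_lt (min_le_left _ _) (by linarith), ?_⟩
      have := min_le_right (b / 2) (μ * c₀ / (216 * M))
      rw [le_div_iff₀ (by positivity)] at this
      linarith
    obtain ⟨t₂, ht₂, hh⟩ := hcut δ hδ
    refine ⟨b - δ, fun y hy hy0 hpos hle => ⟨x, hxC, hx0, by linarith⟩, ?_⟩
    refine ⟨min (min t₁ t₂) (δ / M), by positivity, fun t ht htt => ?_⟩
    have l1 : t < t₁ := lt_of_lt_of_le htt ((min_le_left _ _).trans (min_le_left _ _))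
    have l2 : t < t₂ := lt_of_lt_of_le htt ((min_le_left _ _).trans (min_le_right _ _))
    have l3 : t < δ / M := lt_of_lt_of_le htt (min_le_right _ _)
    rw [lt_div_iff₀ hM] at l3
    refine (bad_measure h hk (b := b) ht.le hδ.le inter_subset_left ?_ (by linarith)).trans ?_
    · rintro p ⟨hp, hpz⟩
      have hpz : b - δ < ⟪p - r₀, z⟫ := hpz
      have := hh p (hSC t p hp).1 (lt_of_le_of_lt (hSC t p hp).2 l2)
      rw [abs_le]; constructor <;> linarith
    · calc (k : ℝ≥0∞) * ENNReal.ofReal (216 * (M * t * δ))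
          ≤ k * ENNReal.ofReal (μ * (c₀ * t)) := by
            refine mul_le_mul' le_rfl (ENNReal.ofReal_le_ofReal ?_)
            nlinarith
        _ = ENNReal.ofReal μ * (k * ENNReal.ofReal (c₀ * t)) := by
            rw [ENNReal.ofReal_mul hμ.le]; ring
        _ ≤ _ := by gcongr; exact hlow t ht l1

lemma setup_measure {C : Set E3} {r₀ w m z e : E3} {c s M : ℝ} (h : Setup C r₀ w m z e c s M)
    {ε : ℝ} (hε : 0 < ε) : ∃ t₀ > 0, ∀ t, 0 < t → t < t₀ →
      μH[2] (Sset C r₀ e t) ≤ ENNReal.ofReal (1 / c + ε) * μH[2] (Bset C r₀ e t) := by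
  have hc := h.c_pos
  obtain ⟨b', hb, t₁, ht₁, hb1⟩ := top_part h (μ := ε / 3) (by positivity)
  obtain ⟨a', ha, t₂, ht₂, ha1⟩ := top_part h.neg (μ := ε / 3) (by positivity)
  obtain ⟨η, hη, hη1, hηε⟩ : ∃ η > 0, η ≤ 1 ∧ 5 * η / c ^ 2 * (1 / c) ≤ ε / 3 := by
    refine ⟨min 1 (ε / 3 * c ^ 3 / 5), by positivity, min_le_left _ _, ?_⟩
    have := min_le_right 1 (ε / 3 * c ^ 3 / 5)
    rw [div_mul_div_comm, div_le_iff₀ (by positivity)]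
    have e1 : c ^ 2 * c = c ^ 3 := by ring
    rw [e1]; linarith
  obtain ⟨t₃, ht₃, hn⟩ := good_normals h hη hb ha
  refine ⟨min (min t₁ t₂) t₃, by positivity, fun t ht htt => ?_⟩
  have l1 : t < t₁ := lt_of_lt_of_le htt ((min_le_left _ _).trans (min_le_left _ _))
  have l2 : t < t₂ := lt_of_lt_of_le htt ((min_le_left _ _).trans (min_le_right _ _))
  have l3 : t < t₃ := lt_of_lt_of_le htt (min_le_right _ _)
  have hcov : Sset C r₀ e t ⊆
      (Sset C r₀ e t ∩ {p | ⟪p - r₀, z⟫ ≤ b' ∧ ⟪p - r₀, -z⟫ ≤ a'}) ∪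
      ((Sset C r₀ e t ∩ {p | b' < ⟪p - r₀, z⟫}) ∪ (Sset C r₀ e t ∩ {p | a' < ⟪p - r₀, -z⟫})) := by
    intro p hp
    by_cases c1 : ⟪p - r₀, z⟫ ≤ b'
    · by_cases c2 : ⟪p - r₀, -z⟫ ≤ a'
      · exact Or.inl ⟨hp, c1, c2⟩
      · exact Or.inr (Or.inr ⟨hp, not_le.mp c2⟩)
    · exact Or.inr (Or.inl ⟨hp, not_le.mp c1⟩)
  refine (measure_mono hcov).trans ((measure_union_le _ _).trans ((add_le_add
    (good_measure h hη hη1 l3 hn) ((measure_union_le _ _).trans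
      (add_le_add (hb1 t ht l1) (ha1 t ht l2)))).trans ?_))
  rw [← add_mul, ← add_mul, ← ENNReal.ofReal_add (by positivity) (by positivity),
    ← ENNReal.ofReal_add (by positivity) (by positivity)]
  refine mul_le_mul' (ENNReal.ofReal_le_ofReal ?_) le_rfl
  rw [add_mul, one_mul]
  linarith

lemma bound_aux (l₁ l₂ c s u₁ u₂ : ℝ) (hl₁ : 0 < l₁) (hl₂ : 0 < l₂) (hc : 0 < c) (hs : 0 < s)
    (d1 : u₁ ≤ 0) (d2 : u₂ ≤ 0) :
    |(u₁ - u₂) * (1 / (2 * s))| ≤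
        (1 / l₁ + 1 / l₂) * (1 / (2 * c) + 1 / (2 * s)) * (-(l₁ * u₁ + l₂ * u₂)) ∧
      |(u₁ + u₂) * (1 / (2 * c))| ≤
        (1 / l₁ + 1 / l₂) * (1 / (2 * c) + 1 / (2 * s)) * (-(l₁ * u₁ + l₂ * u₂)) := by
  have p1 : l₁ * u₁ ≤ 0 := mul_nonpos_of_nonneg_of_nonpos hl₁.le d1
  have p2 : l₂ * u₂ ≤ 0 := mul_nonpos_of_nonneg_of_nonpos hl₂.le d2
  obtain ⟨H, hH⟩ : ∃ H, H = -(l₁ * u₁ + l₂ * u₂) := ⟨_, rfl⟩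
  rw [← hH]
  have b1 : -u₁ ≤ 1 / l₁ * H := by
    rw [div_mul_eq_mul_div, le_div_iff₀ hl₁, hH]; linarith
  have b2 : -u₂ ≤ 1 / l₂ * H := by
    rw [div_mul_eq_mul_div, le_div_iff₀ hl₂, hH]; linarith
  have hA : -u₁ - u₂ ≤ (1 / l₁ + 1 / l₂) * H := by rw [add_mul]; linarith
  have hcc : 0 < 1 / (2 * c) := by positivity
  have hss : 0 < 1 / (2 * s) := by positivity
  generalize (1 / l₁ + 1 / l₂) = A at *
  generalize 1 / (2 * c) = c' at *
  generalize 1 / (2 * s) = s' at *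
  have hA0 : 0 ≤ A * H := by linarith
  have q1 := mul_nonneg hA0 hcc.le
  have q2 := mul_nonneg hA0 hss.le
  have q3 : A * (c' + s') * H = A * H * c' + A * H * s' := by ring
  constructor
  · rw [abs_mul, abs_of_pos hss, q3]
    have : |u₁ - u₂| ≤ A * H := abs_le.mpr ⟨by linarith, by linarith⟩
    have := mul_le_mul_of_nonneg_right this hss.le
    linarith
  · rw [abs_mul, abs_of_pos hcc, q3]
    have : |u₁ + u₂| ≤ A * H := abs_le.mpr ⟨by linarith, by linarith⟩
    have := mul_le_mul_of_nonneg_right this hcc.le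
    linarith

set_option maxHeartbeats 1000000 in
lemma exists_setup (C : Set E3) (r₀ e₁ e₂ e : E3) (lam₁ lam₂ : ℝ)
    (hC : IsConvexBody C) (hr₀ : r₀ ∈ frontier C)
    (he₁ : ‖e₁‖ = 1) (he₂ : ‖e₂‖ = 1) (hne : e₁ ≠ e₂) (hne' : e₁ ≠ -e₂)
    (hcone : tanCone C r₀ = dihedral e₁ e₂)
    (hl₁ : 0 < lam₁) (hl₂ : 0 < lam₂) (he : e = lam₁ • e₁ + lam₂ • e₂) :
    ∃ w m z : E3, ∃ s M : ℝ, Setup C r₀ w m z e (‖e₁ + e₂‖ / 2) s M := by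
  set c := ‖e₁ + e₂‖ / 2 with hc
  set s := ‖e₁ - e₂‖ / 2 with hs
  have hcpos : 0 < c := by
    have : 0 < ‖e₁ + e₂‖ := norm_pos_iff.mpr fun h => hne' (eq_neg_of_add_eq_zero_left h)
    positivity
  have hspos : 0 < s := by
    have : 0 < ‖e₁ - e₂‖ := norm_pos_iff.mpr (sub_ne_zero.mpr hne)
    positivity
  have h11 : ⟪e₁, e₁⟫ = 1 := by rw [real_inner_self_eq_norm_sq, he₁]; norm_num
  have h22 : ⟪e₂, e₂⟫ = 1 := by rw [real_inner_self_eq_norm_sq, he₂]; norm_num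
  have h21 : ⟪e₂, e₁⟫ = ⟪e₁, e₂⟫ := real_inner_comm _ _
  have hc2 : 4 * c ^ 2 = 2 + 2 * ⟪e₁, e₂⟫ := by
    have := norm_add_sq_real e₁ e₂
    rw [he₁, he₂] at this
    rw [hc]; linarith
  have hs2 : 4 * s ^ 2 = 2 - 2 * ⟪e₁, e₂⟫ := by
    have := norm_sub_sq_real e₁ e₂
    rw [he₁, he₂] at this
    rw [hs]; linarith
  have hcs : c ^ 2 + s ^ 2 = 1 := by linarith
  set m : E3 := (2 * c)⁻¹ • (e₁ + e₂) with hm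
  set w : E3 := (2 * s)⁻¹ • (e₁ - e₂) with hw
  have mm : ⟪m, m⟫ = 1 := by
    rw [hm, real_inner_smul_left, real_inner_smul_right, inner_add_left, inner_add_right,
      inner_add_right, h11, h22, h21]
    field_simp; linarith
  have ww : ⟪w, w⟫ = 1 := by
    rw [hw, real_inner_smul_left, real_inner_smul_right, inner_sub_left, inner_sub_right,
      inner_sub_right, h11, h22, h21]
    field_simp; linarith
  have wm : ⟪w, m⟫ = 0 := by
    rw [hw, hm, real_inner_smul_left, real_inner_smul_right, inner_sub_left, inner_add_right,
      inner_add_right, h11, h22, h21]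
    ring
  have mw : ⟪m, w⟫ = 0 := by rw [real_inner_comm]; exact wm
  obtain ⟨B, hB⟩ := Orthonormal.exists_orthonormalBasis_extension_of_card_eq (𝕜 := ℝ) (E := E3)
    (ι := Fin 3) (by simp) (v := ![w, m, 0]) (s := {0, 1}) (by
      rw [orthonormal_iff_ite]
      rintro ⟨i, hi⟩ ⟨j, hj⟩
      rcases hi with rfl | rfl <;> rcases hj with rfl | rfl <;>
        simp [ww, mm, wm, mw, Subtype.ext_iff, -inner_self_eq_norm_sq_to_K])
  have hB0 : B 0 = w := by simpa using hB 0 (by simp)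
  have hB1 : B 1 = m := by simpa using hB 1 (by simp)
  set z := B 2 with hz
  have zz : ⟪z, z⟫ = 1 := by rw [real_inner_self_eq_norm_sq, hz, B.orthonormal.1]; norm_num
  have wz : ⟪w, z⟫ = 0 := by rw [← hB0, hz]; exact B.orthonormal.2 (by decide)
  have mz : ⟪m, z⟫ = 0 := by rw [← hB1, hz]; exact B.orthonormal.2 (by decide)
  have dec : ∀ x y : E3,
      ⟪x, y⟫ = ⟪x, w⟫ * ⟪y, w⟫ + ⟪x, m⟫ * ⟪y, m⟫ + ⟪x, z⟫ * ⟪y, z⟫ := by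
    intro x y
    have := B.sum_inner_mul_inner x y
    rw [Fin.sum_univ_three, hB0, hB1, ← hz] at this
    rw [← this, real_inner_comm w y, real_inner_comm m y, real_inner_comm z y]
  have E1 : e₁ = c • m + s • w := by
    rw [hm, hw, smul_smul, smul_smul]
    have a1 : c * (2 * c)⁻¹ = 1 / 2 := by field_simp
    have a2 : s * (2 * s)⁻¹ = 1 / 2 := by field_simp
    rw [a1, a2]; module
  have E2' : e₂ = c • m - s • w := by
    rw [hm, hw, smul_smul, smul_smul]
    have a1 : c * (2 * c)⁻¹ = 1 / 2 := by field_simp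
    have a2 : s * (2 * s)⁻¹ = 1 / 2 := by field_simp
    rw [a1, a2]; module
  clear_value m w z
  have i1 : ∀ v : E3, ⟪v, e₁⟫ = c * ⟪v, m⟫ + s * ⟪v, w⟫ := fun v => by
    conv_lhs => rw [E1]
    rw [inner_add_right, real_inner_smul_right, real_inner_smul_right]
  have i2 : ∀ v : E3, ⟪v, e₂⟫ = c * ⟪v, m⟫ - s * ⟪v, w⟫ := fun v => by
    conv_lhs => rw [E2']
    rw [inner_sub_right, real_inner_smul_right, real_inner_smul_right]
  have ie : ∀ v : E3, ⟪v, e⟫ = lam₁ * ⟪v, e₁⟫ + lam₂ * ⟪v, e₂⟫ := fun v => by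
    rw [he, inner_add_right, real_inner_smul_right, real_inner_smul_right]
  have zm : ⟪z, m⟫ = 0 := by rw [real_inner_comm]; exact mz
  have zw : ⟪z, w⟫ = 0 := by rw [real_inner_comm]; exact wz
  have hmemC : r₀ ∈ C := hC.1.isClosed.frontier_subset hr₀
  refine ⟨w, m, z, s, (1 / lam₁ + 1 / lam₂) * (1 / (2 * c) + 1 / (2 * s)), hC, hmemC, dec, ww,
    mm, zz, wm, wz, mz, hcpos, hspos, hcs, ?_, ?_, ?_, by positivity, ?_⟩
  · rw [real_inner_comm, ie, i1, i2, zm, zw]; ring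
  · rw [real_inner_comm, ie, i1, i2, mm, mw]
    have : 0 < (lam₁ + lam₂) * c := by positivity
    linarith
  · intro n hn
    have key : ∀ v ∈ dihedral e₁ e₂, ⟪v, n⟫ ≤ 0 := by
      rw [← hcone]
      intro v hv
      have hcl : IsClosed {v : E3 | ⟪v, n⟫ ≤ 0} := isClosed_le (by fun_prop) (by fun_prop)
      refine closure_minimal ?_ hcl hv
      rintro _ ⟨a, r, hr, ha, rfl⟩
      show ⟪_, n⟫ ≤ 0
      rw [real_inner_smul_left]
      exact mul_nonpos_of_nonneg_of_nonpos ha (hn.2 r hr)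
    have k1 := key z (by
      constructor
      · rw [i1, zm, zw]; simp
      · rw [i2, zm, zw]; simp)
    have k2 := key (-z) (by
      constructor
      · rw [inner_neg_left, i1, zm, zw]; simp
      · rw [inner_neg_left, i2, zm, zw]; simp)
    have hsc : 0 < s * c := by positivity
    have k3 := key (c • w - s • m) (by
      constructor
      · rw [i1]
        simp only [inner_sub_left, real_inner_smul_left, wm, mw, ww, mm]
        linarith
      · rw [i2]
        simp only [inner_sub_left, real_inner_smul_left, wm, mw, ww, mm]
        linarith)
    have k4 := key (-(c • w) - s • m) (by
      constructor
      · rw [i1]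
        simp only [inner_sub_left, inner_neg_left, real_inner_smul_left, wm, mw, ww, mm]
        linarith
      · rw [i2]
        simp only [inner_sub_left, inner_neg_left, real_inner_smul_left, wm, mw, ww, mm]
        linarith)
    simp only [inner_sub_left, inner_neg_left, real_inner_smul_left] at k2 k3 k4
    rw [real_inner_comm z n, real_inner_comm w n, real_inner_comm m n]
    refine ⟨by linarith, ?_⟩
    have habs : c * |⟪w, n⟫| = |c * ⟪w, n⟫| := by rw [abs_mul, abs_of_pos hcpos]
    rw [habs, abs_le]
    constructor <;> linarith
  · intro p hp
    have hd : p - r₀ ∈ dihedral e₁ e₂ := by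
      rw [← hcone]
      exact subset_closure ⟨1, p, hp, zero_le_one, by rw [one_smul]⟩
    obtain ⟨d1, d2⟩ := hd
    have hpm : ⟪p - r₀, m⟫ = (⟪p - r₀, e₁⟫ + ⟪p - r₀, e₂⟫) * (1 / (2 * c)) := by
      rw [i1, i2]; field_simp; ring
    have hpw : ⟪p - r₀, w⟫ = (⟪p - r₀, e₁⟫ - ⟪p - r₀, e₂⟫) * (1 / (2 * s)) := by
      rw [i1, i2]; field_simp; ring
    have hpe := ie (p - r₀)
    rw [hpe, hpm, hpw]
    exact bound_aux _ _ _ _ _ _ hl₁ hl₂ hcpos hspos d1 d2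
/-- **Lemma 1 of the paper.** `limsup_{t→0⁺} |S_t|/|B_t| ≤ √2 / √(1 + ⟪e₁, e₂⟫)`;
in particular the ratio of the area of `S_t` to the area of `B_t` stays bounded. -/
theorem limsup_area_ratio_le
    (C : Set E3) (r₀ e₁ e₂ e : E3) (lam₁ lam₂ : ℝ)
    (hC : IsConvexBody C) (hr₀ : r₀ ∈ frontier C)
    (he₁ : ‖e₁‖ = 1) (he₂ : ‖e₂‖ = 1) (hne : e₁ ≠ e₂) (hne' : e₁ ≠ -e₂)
    (hcone : tanCone C r₀ = dihedral e₁ e₂)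
    (hl₁ : 0 < lam₁) (hl₂ : 0 < lam₂) (he : e = lam₁ • e₁ + lam₂ • e₂) (hnorm : ‖e‖ = 1) :
    Filter.limsup
      (fun t => (μH[2] (Sset C r₀ e t)).toReal / (μH[2] (Bset C r₀ e t)).toReal)
      (𝓝[>] (0 : ℝ))
      ≤ Real.sqrt 2 / Real.sqrt (1 + ⟪e₁, e₂⟫) := by

  obtain ⟨w, m, z, s, M, h⟩ := exists_setup C r₀ e₁ e₂ e lam₁ lam₂ hC hr₀ he₁ he₂ hne hne'
    hcone hl₁ hl₂ he
  have hconst : Real.sqrt 2 / Real.sqrt (1 + ⟪e₁, e₂⟫) = 1 / (‖e₁ + e₂‖ / 2) := by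
    have h1 : 1 + ⟪e₁, e₂⟫ = ‖e₁ + e₂‖ ^ 2 / 2 := by
      have := norm_add_sq_real e₁ e₂
      rw [he₁, he₂] at this
      linarith
    rw [h1, Real.sqrt_div (by positivity), Real.sqrt_sq (norm_nonneg _), div_div_eq_mul_div,
      Real.mul_self_sqrt (by norm_num), one_div_div]
  rw [hconst]
  set c := ‖e₁ + e₂‖ / 2 with hc
  have hcpos := h.c_pos
  refine le_of_forall_pos_le_add fun ε hε => ?_
  obtain ⟨t₀, ht₀, hmain⟩ := setup_measure h hε
  refine Filter.limsup_le_of_le ?_ ?_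
  · refine Filter.isCoboundedUnder_le_of_le (x := 0) _ fun t => ?_
    positivity
  · filter_upwards [Ioo_mem_nhdsGT ht₀] with t ht
    have h1 := hmain t ht.1 ht.2
    rcases eq_or_ne (μH[2] (Bset C r₀ e t)) ∞ with htop | hfin
    · rw [htop, ENNReal.toReal_top, div_zero]; positivity
    · have h2 := ENNReal.toReal_mono (ENNReal.mul_ne_top ENNReal.ofReal_ne_top hfin) h1
      rw [ENNReal.toReal_mul, ENNReal.toReal_ofReal (by positivity)] at h2
      exact div_le_of_le_mul₀ ENNReal.toReal_nonneg (by positivity) h2
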